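/- For every d ≥ 0, let p = ecdeacdbe · g(0323) · g(f(0323)) · … · g(f^d(0323)) and let s = g(f^d(012)) · g(f^{d-1}(012)) · … · g(f(012)) · g(012) · abcdb. Then the word T = p·s is a conjugate of g(f^d(01240323)) = g(f^{d+1}(4)) and T is not a factor of w₅ = G(F^ω(0)). -/

import Mathlib

/-- The morphism F on the alphabet Σ = {0,1,2,3,4}. -/
def F : Fin 5 → List (Fin 5)
  | 0 => [0, 1]
  | 1 => [2]
  | 2 => [0, 3]
  | 3 => [2, 4]
  | 4 => [2, 3]

/-- Extension of F to words. -/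
def Fw (w : List (Fin 5)) : List (Fin 5) := w.flatMap F

/-- `u` is a factor of the fixed point F^ω(0). -/
def FactorF (u : List (Fin 5)) : Prop := ∃ n, u <:+: Fw^[n] [0]

/-- `v` is a conjugate (cyclic rotation) of `u`. -/
def Conj (u v : List (Fin 5)) : Prop := ∃ s t, u = s ++ t ∧ v = t ++ s

/-- The morphism G : Σ* → Δ*, where Δ = {a,b,c,d,e} is coded as
`a = 0, b = 1, c = 2, d = 3, e = 4`. -/
def G : Fin 5 → List (Fin 5)
  | 0 => [0, 1, 2, 3]      -- abcd
  | 1 => []                -- ε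
  | 2 => [4, 0, 2, 3]      -- eacd
  | 3 => [1, 4, 2, 3]      -- becd
  | 4 => [1, 4]            -- be

/-- Extension of G to words. -/
def Gw (w : List (Fin 5)) : List (Fin 5) := w.flatMap G

/-- `u` is a factor of w₅ = G(F^ω(0)). -/
def FactorW5 (u : List (Fin 5)) : Prop := ∃ n, u <:+: Gw (Fw^[n] [0])

/-- The morphism f = F³ on words. -/
def fword (w : List (Fin 5)) : List (Fin 5) := Fw (Fw (Fw w))

/-- The morphism g = G ∘ F² on words. -/
def gword (w : List (Fin 5)) : List (Fin 5) := Gw (Fw (Fw w))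

/-- g(f^k(w)). -/
def gf (k : ℕ) (w : List (Fin 5)) : List (Fin 5) := gword (fword^[k] w)

/-- p = ecdeacdbe · g(0323) · g(f(0323)) · … · g(f^d(0323)). -/
def p01240323 (d : ℕ) : List (Fin 5) :=
  [4, 2, 3, 4, 0, 2, 3, 1, 4] ++
    ((List.range (d + 1)).map (fun k => gf k [0, 3, 2, 3])).flatten

/-- s = g(f^d(012)) · g(f^{d-1}(012)) · … · g(012) · abcdb. -/
def s01240323 (d : ℕ) : List (Fin 5) :=
  ((List.range (d + 1)).reverse.map (fun k => gf k [0, 1, 2])).flatten ++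
    [0, 1, 2, 3, 1]

/-- Every block `h a` starts with `01`, and in a concatenation of blocks the word `01` occurs
only at the beginning of a block; distinct letters have distinct blocks. -/
structure Marked (h : Fin 5 → List (Fin 5)) : Prop where
  isPrefix : ∀ a, [0, 1] <+: h a
  not_infix_tail : ∀ a, ¬ [0, 1] <:+: (h a).tail
  not_suffix : ∀ a, ¬ [0] <:+ h a
  inj : ∀ a b, h a = h b → a = b

theorem Marked.split {h : Fin 5 → List (Fin 5)} (hh : Marked h) {y x z : List (Fin 5)}
    (e : y.flatMap h = x ++ z) (hz : [0, 1] <+: z) :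
    ∃ y₁ y₂, y = y₁ ++ y₂ ∧ y₁.flatMap h = x ∧ y₂.flatMap h = z := by
  induction y generalizing x with
  | nil =>
    obtain ⟨z, rfl⟩ := hz
    simp at e
  | cons a y ih =>
    rcases x with _ | ⟨i, x⟩
    · exact ⟨[], a :: y, rfl, rfl, e⟩
    rw [List.flatMap_cons, List.append_eq_append_iff] at e
    rcases e with ⟨x', hx, hy⟩ | ⟨c, ha, hc⟩
    · obtain ⟨y₁, y₂, rfl, h₁, h₂⟩ := ih hy
      exact ⟨a :: y₁, y₂, rfl, by rw [List.flatMap_cons, h₁, hx], h₂⟩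
    · obtain ⟨z, rfl⟩ := hz
      rcases c with _ | ⟨j, _ | ⟨k, c⟩⟩
      · obtain ⟨y₁, y₂, rfl, h₁, h₂⟩ := ih (x := []) hc.symm
        exact ⟨a :: y₁, y₂, rfl, by rw [List.flatMap_cons, h₁, ha]; simp, h₂⟩
      · simp only [List.cons_append, List.cons.injEq] at hc
        obtain ⟨rfl, -⟩ := hc
        exact absurd ⟨_, ha.symm⟩ (hh.not_suffix a)
      · simp only [List.cons_append, List.cons.injEq] at hc
        obtain ⟨rfl, rfl, -⟩ := hc
        exact absurd ⟨x, c, by rw [ha]; simp⟩ (hh.not_infix_tail a)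

theorem Marked.isPrefix_flatMap_append {h : Fin 5 → List (Fin 5)} (hh : Marked h)
    (w : List (Fin 5)) {z : List (Fin 5)} (hz : [0, 1] <+: z) :
    [0, 1] <+: w.flatMap h ++ z := by
  cases w with
  | nil => simpa using hz
  | cons a w =>
    rw [List.flatMap_cons, List.append_assoc]
    exact (hh.isPrefix a).trans (List.prefix_append _ _)

theorem Marked.flatMap_eq_block {h : Fin 5 → List (Fin 5)} (hh : Marked h) {a : Fin 5}
    {y : List (Fin 5)} (e : y.flatMap h = h a) : y = [a] := by
  rcases y with _ | ⟨b, _ | ⟨c, y⟩⟩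
  · have := hh.isPrefix a
    simp [← e] at this
  · rw [hh.inj b a (by simpa using e)]
  · exfalso
    apply hh.not_infix_tail a
    obtain ⟨s, hs⟩ := hh.isPrefix b
    obtain ⟨t, ht⟩ := hh.isPrefix c
    refine ⟨1 :: s, t ++ y.flatMap h, ?_⟩
    rw [← e, List.flatMap_cons, List.flatMap_cons, ← hs, ← ht]
    simp

theorem Marked.cancel_left {h : Fin 5 → List (Fin 5)} (hh : Marked h) {w y z : List (Fin 5)}
    (e : y.flatMap h = w.flatMap h ++ z) (hz : [0, 1] <+: z) :
    ∃ y', y = w ++ y' ∧ y'.flatMap h = z := by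
  induction w generalizing y with
  | nil => exact ⟨y, rfl, by simpa using e⟩
  | cons a w ih =>
    rw [List.flatMap_cons, List.append_assoc] at e
    obtain ⟨y₁, y₂, rfl, h₁, h₂⟩ := hh.split e (hh.isPrefix_flatMap_append w hz)
    obtain ⟨y', rfl, hy'⟩ := ih h₂
    exact ⟨y', by simp [hh.flatMap_eq_block h₁], hy'⟩

/-- Desubstitution: if `L` is a suffix of a word of blocks only when that word ends in the block
of `4`, and `R` is a prefix of a word of blocks only when its first letter lies in `{1, 3, 4}`,
then an occurrence of `L h(w) R` in `h(y)` comes from an occurrence of `4 w c` in `y`. -/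
theorem Marked.desubstitute {h : Fin 5 → List (Fin 5)} (hh : Marked h)
    {L R w y : List (Fin 5)} (hR : [0, 1] <+: R) (hL₀ : L ≠ [])
    (hL : ∀ a l v, v ++ h a = l ++ L → a = 4)
    (hR' : ∀ a r v, h a ++ v = R ++ r → a ∈ ({1, 3, 4} : Set (Fin 5)))
    (e : L ++ w.flatMap h ++ R <:+: y.flatMap h) :
    ∃ c ∈ ({1, 3, 4} : Set (Fin 5)), 4 :: w ++ [c] <:+: y := by
  obtain ⟨l, r, e⟩ := e
  have e' : y.flatMap h = (l ++ L) ++ (w.flatMap h ++ (R ++ r)) := by simp [← e]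
  have hRr : [0, 1] <+: R ++ r := hR.trans (List.prefix_append _ _)
  obtain ⟨y₁, y₂, rfl, h₁, h₂⟩ := hh.split e' (hh.isPrefix_flatMap_append w hRr)
  obtain ⟨y₃, rfl, h₃⟩ := hh.cancel_left h₂ hRr
  rcases y₁.eq_nil_or_concat' with rfl | ⟨y₀, a, rfl⟩
  · simp [hL₀] at h₁
  rcases y₃ with _ | ⟨c, y₃⟩
  · simp [← h₃] at hRr
  obtain rfl : a = 4 := hL a l (y₀.flatMap h) (by simpa using h₁)
  exact ⟨c, hR' c r (y₃.flatMap h) (by simpa using h₃), y₀, y₃, by simp⟩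

theorem Fw_append (u v : List (Fin 5)) : Fw (u ++ v) = Fw u ++ Fw v := by simp [Fw]

theorem Gw_append (u v : List (Fin 5)) : Gw (u ++ v) = Gw u ++ Gw v := by simp [Gw]

theorem fword_append (u v : List (Fin 5)) : fword (u ++ v) = fword u ++ fword v := by
  simp [fword, Fw_append]

theorem gword_append (u v : List (Fin 5)) : gword (u ++ v) = gword u ++ gword v := by
  simp [gword, Fw_append, Gw_append]

theorem fword_eq_flatMap (w : List (Fin 5)) : fword w = w.flatMap (fun a => fword [a]) := by
  induction w with
  | nil => rfl
  | cons a w ih => rw [List.flatMap_cons, ← ih, ← fword_append, List.singleton_append]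

theorem gword_eq_flatMap (w : List (Fin 5)) : gword w = w.flatMap (fun a => gword [a]) := by
  induction w with
  | nil => rfl
  | cons a w ih => rw [List.flatMap_cons, ← ih, ← gword_append, List.singleton_append]

theorem fword_iterate_append (n : ℕ) (u v : List (Fin 5)) :
    fword^[n] (u ++ v) = fword^[n] u ++ fword^[n] v := by
  induction n generalizing u v with
  | zero => rfl
  | succ n ih => simp [fword_append, ih]

theorem gf_append (n : ℕ) (u v : List (Fin 5)) : gf n (u ++ v) = gf n u ++ gf n v := by
  simp [gf, fword_iterate_append, gword_append]

theorem marked_fword : Marked (fun a => fword [a]) := by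
  constructor <;> decide

theorem marked_gword : Marked (fun a => gword [a]) := by
  constructor <;> decide

/-- The word `0323 · f(0323) · … · f^{n-1}(0323)`. -/
def leftArm : ℕ → List (Fin 5)
  | 0 => []
  | n + 1 => [0, 3, 2, 3] ++ fword (leftArm n)

/-- The word `f^{n-1}(012) · … · f(012) · 012`. -/
def rightArm : ℕ → List (Fin 5)
  | 0 => []
  | n + 1 => fword (rightArm n) ++ [0, 1, 2]

theorem leftArm_succ (n : ℕ) : leftArm (n + 1) = leftArm n ++ fword^[n] [0, 3, 2, 3] := by
  induction n with
  | zero => rfl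
  | succ n ih =>
    calc leftArm (n + 2) = [0, 3, 2, 3] ++ fword (leftArm (n + 1)) := rfl
      _ = ([0, 3, 2, 3] ++ fword (leftArm n)) ++ fword (fword^[n] [0, 3, 2, 3]) := by
        rw [ih, fword_append, List.append_assoc]
      _ = leftArm (n + 1) ++ fword^[n + 1] [0, 3, 2, 3] := by
        rw [Function.iterate_succ_apply', leftArm]

theorem rightArm_succ (n : ℕ) : rightArm (n + 1) = fword^[n] [0, 1, 2] ++ rightArm n := by
  induction n with
  | zero => rfl
  | succ n ih =>
    calc rightArm (n + 2) = fword (rightArm (n + 1)) ++ [0, 1, 2] := rfl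
      _ = fword (fword^[n] [0, 1, 2]) ++ (fword (rightArm n) ++ [0, 1, 2]) := by
        rw [ih, fword_append, List.append_assoc]
      _ = fword^[n + 1] [0, 1, 2] ++ rightArm (n + 1) := by
        rw [Function.iterate_succ_apply', rightArm]

theorem gword_leftArm (n : ℕ) :
    gword (leftArm n) = ((List.range n).map (fun k => gf k [0, 3, 2, 3])).flatten := by
  induction n with
  | zero => rfl
  | succ n ih => simp [leftArm_succ, gword_append, ih, List.range_succ, gf]

theorem gword_rightArm (n : ℕ) :
    gword (rightArm n) = ((List.range n).reverse.map (fun k => gf k [0, 1, 2])).flatten := by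
  induction n with
  | zero => rfl
  | succ n ih => simp [rightArm_succ, gword_append, ih, List.range_succ, gf]

theorem p_eq (d : ℕ) :
    p01240323 d = [4, 2, 3, 4, 0, 2, 3, 1, 4] ++ gword (leftArm (d + 1)) := by
  rw [gword_leftArm, p01240323]

theorem s_eq (d : ℕ) : s01240323 d = gword (rightArm (d + 1)) ++ [0, 1, 2, 3, 1] := by
  rw [gword_rightArm, s01240323]

theorem fword_iterate_four (n : ℕ) : fword^[n] [4] = rightArm n ++ [4] ++ leftArm n := by
  induction n with
  | zero => rfl
  | succ n ih =>
    have h4 : fword [4] = [0, 1, 2] ++ [4] ++ [0, 3, 2, 3] := rfl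
    simp only [Function.iterate_succ_apply', ih, fword_append, h4, rightArm, leftArm,
      List.append_assoc]

theorem conj_gf (d : ℕ) :
    Conj (gf d [0, 1, 2, 4, 0, 3, 2, 3]) (p01240323 d ++ s01240323 d) := by
  have h4 : gf d [4] = gword (rightArm d) ++ [0, 1, 2, 3, 1] ++
      ([4, 2, 3, 4, 0, 2, 3, 1, 4] ++ gword (leftArm d)) := by
    have : gword [4] = [0, 1, 2, 3, 1] ++ [4, 2, 3, 4, 0, 2, 3, 1, 4] := rfl
    simp only [gf, fword_iterate_four, gword_append, this, List.append_assoc]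
  refine ⟨s01240323 d, p01240323 d, ?_, rfl⟩
  change gf d ([0, 1, 2] ++ [4] ++ [0, 3, 2, 3]) = _
  rw [gf_append, gf_append, h4, s_eq, p_eq, leftArm_succ, rightArm_succ, gword_append,
    gword_append]
  simp only [gf, List.append_assoc]

theorem desubstitute_gword {w y : List (Fin 5)}
    (e : [4, 2, 3, 4, 0, 2, 3, 1, 4] ++ gword w ++ [0, 1, 2, 3, 1] <:+: gword y) :
    ∃ c ∈ ({1, 3, 4} : Set (Fin 5)), 4 :: w ++ [c] <:+: y := by
  rw [gword_eq_flatMap w, gword_eq_flatMap y] at e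
  refine marked_gword.desubstitute (by decide) (by decide) ?_ ?_ e
  · intro a l v h
    have h := congrArg List.reverse h
    fin_cases a <;> simp [gword, Gw, Fw, F, G] at h ⊢
  · intro a r v h
    fin_cases a <;> simp [gword, Gw, Fw, F, G] at h ⊢

theorem desubstitute_fword {w y : List (Fin 5)} {c : Fin 5}
    (hc : c ∈ ({1, 3, 4} : Set (Fin 5)))
    (e : [4, 0, 3, 2, 3] ++ fword w ++ [0, 1, 2, c] <:+: fword y) :
    ∃ c ∈ ({1, 3, 4} : Set (Fin 5)), 4 :: w ++ [c] <:+: y := by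
  rw [fword_eq_flatMap w, fword_eq_flatMap y] at e
  refine marked_fword.desubstitute (by simp) (by decide) ?_ ?_ e
  · intro a l v h
    have h := congrArg List.reverse h
    fin_cases a <;> simp [fword, Fw, F] at h ⊢
  · intro a r v h
    fin_cases a <;> simp [fword, Fw, F] at h ⊢ <;> simp [← h.1] at hc

theorem desubstitute_arms (n : ℕ) {y : List (Fin 5)}
    (e : ∃ c ∈ ({1, 3, 4} : Set (Fin 5)),
      4 :: (leftArm n ++ rightArm n) ++ [c] <:+: fword^[n] y) :
    ∃ c ∈ ({1, 3, 4} : Set (Fin 5)), [4, c] <:+: y := by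
  induction n with
  | zero => exact e
  | succ n ih =>
    obtain ⟨c, hc, e⟩ := e
    rw [Function.iterate_succ_apply'] at e
    apply ih
    refine desubstitute_fword hc ?_
    simpa [leftArm, rightArm, fword_append] using e

theorem not_four_infix_Fw {c : Fin 5} (hc : c ∈ ({1, 3, 4} : Set (Fin 5)))
    (y : List (Fin 5)) : ¬ [4, c] <:+: Fw y := by
  have key : ∀ y : List (Fin 5), ¬ [c] <+: Fw y := by
    rintro (_ | ⟨a, y⟩)
    · simp [Fw]
    · rcases hc with rfl | rfl | rfl <;> fin_cases a <;> simp [Fw, F]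
  induction y with
  | nil => simp [Fw]
  | cons a y ih =>
    have ha : Fw (a :: y) = F a ++ Fw y := rfl
    have key := key y
    rw [ha]
    rcases hc with rfl | rfl | rfl <;> fin_cases a <;>
      simp_all [F, List.infix_cons_iff, List.cons_prefix_cons]

theorem Fw_iterate_append (n : ℕ) (u v : List (Fin 5)) :
    Fw^[n] (u ++ v) = Fw^[n] u ++ Fw^[n] v := by
  induction n generalizing u v with
  | zero => rfl
  | succ n ih => simp [Fw_append, ih]

theorem Fw_iterate_zero_prefix {m n : ℕ} (hmn : m ≤ n) : Fw^[m] [0] <+: Fw^[n] [0] := by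
  induction n, hmn using Nat.le_induction with
  | base => exact List.prefix_rfl
  | succ n _ ih =>
    refine ih.trans ?_
    rw [Function.iterate_succ_apply]
    change _ <+: Fw^[n] ([0] ++ [1])
    rw [Fw_iterate_append]
    exact List.prefix_append _ _

theorem fword_iterate (n : ℕ) (w : List (Fin 5)) : fword^[n] w = Fw^[3 * n] w := by
  rw [Function.iterate_mul]
  rfl

theorem FactorW5.gword_fword {u : List (Fin 5)} (hu : FactorW5 u) :
    ∃ N, ∀ m ≥ N, u <:+: gword (fword^[m] [0]) := by
  obtain ⟨n, hn⟩ := hu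
  refine ⟨n, fun m hm => hn.trans ?_⟩
  rw [gword, fword_iterate, ← Function.iterate_succ_apply' Fw, ← Function.iterate_succ_apply' Fw]
  obtain ⟨t, ht⟩ := Fw_iterate_zero_prefix (show n ≤ (3 * m).succ.succ by omega)
  rw [← ht, Gw_append]
  exact (List.prefix_append _ _).isInfix

theorem conj_gf_01240323_not_factor (d : ℕ) :
    Conj (gf d [0, 1, 2, 4, 0, 3, 2, 3]) (p01240323 d ++ s01240323 d) ∧
    ¬ FactorW5 (p01240323 d ++ s01240323 d) := by
  refine ⟨conj_gf d, fun hT => ?_⟩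
  obtain ⟨N, hN⟩ := hT.gword_fword
  have h := hN (d + 1 + (N + 1)) (by omega)
  have hw : p01240323 d ++ s01240323 d = [4, 2, 3, 4, 0, 2, 3, 1, 4] ++
      gword (leftArm (d + 1) ++ rightArm (d + 1)) ++ [0, 1, 2, 3, 1] := by
    simp only [p_eq, s_eq, gword_append, List.append_assoc]
  rw [hw, Function.iterate_add_apply] at h
  obtain ⟨c, hc, h⟩ := desubstitute_arms (d + 1) (desubstitute_gword h)
  rw [Function.iterate_succ_apply'] at h
  exact not_four_infix_Fw hc _ h
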